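/- Let κ > 0, η > 0, r > 0, ν > 0 and θ ∈ ℝ, and let F(z) = ∫₀^∞ υ^{r/κ − 1} exp(√(2κ/η²)(z − θ)υ − υ²/2) dυ. Then there exists a unique b ∈ ℝ satisfying F(b) = (b + log ν) F'(b), and this b satisfies b + log ν > 0. Moreover, the function z ↦ (z + log ν)/F(z) is strictly increasing on (−∞, b] and strictly decreasing on [b, ∞); in particular (z + log ν)/F(z) ≤ (b + log ν)/F(b) for all z ∈ ℝ. -/

import Mathlib

/-- The increasing solution F of the OU ODE. -/
noncomputable def ouF (κ θ η r : ℝ) (z : ℝ) : ℝ :=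
  ∫ υ in Set.Ioi (0:ℝ),
    υ ^ (r/κ - 1) * Real.exp (Real.sqrt (2*κ/η^2) * (z - θ) * υ - υ^2/2)

open MeasureTheory Set

/-- The function `x ↦ x ^ s * exp (k * x - x ^ 2 / 2)` is integrable on the positive half-line. -/
theorem integrableOn_rpow_mul_exp_linear_sub_sq {s : ℝ} (hs : -1 < s) (k : ℝ) :
    IntegrableOn (fun x : ℝ => x ^ s * Real.exp (k * x - x ^ 2 / 2)) (Ioi 0) := by
  have h := (integrableOn_rpow_mul_exp_neg_mul_sq (b := 1 / 4) (by norm_num) hs).const_mul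
    (Real.exp (k ^ 2))
  refine h.mono' (by fun_prop) ?_
  refine (ae_restrict_iff' measurableSet_Ioi).2 (Filter.Eventually.of_forall fun x hx => ?_)
  have hx' : 0 < x := hx
  have hp : 0 ≤ x ^ s := Real.rpow_nonneg hx'.le s
  rw [Real.norm_of_nonneg (by positivity)]
  calc x ^ s * Real.exp (k * x - x ^ 2 / 2)
      ≤ x ^ s * Real.exp (k ^ 2 + -(1 / 4) * x ^ 2) := by
        gcongr
        nlinarith [sq_nonneg (k - x / 2)]
    _ = Real.exp (k ^ 2) * (x ^ s * Real.exp (-(1 / 4) * x ^ 2)) := by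
        rw [Real.exp_add]; ring

/-- The integral of `x ^ s * exp (k * x - x ^ 2 / 2)` over the positive half-line. -/
noncomputable def gaussMellin (s k : ℝ) : ℝ :=
  ∫ x in Ioi (0 : ℝ), x ^ s * Real.exp (k * x - x ^ 2 / 2)

theorem gaussMellin_pos {s : ℝ} (hs : -1 < s) (k : ℝ) : 0 < gaussMellin s k := by
  have hpos : ∀ x ∈ Ioi (0 : ℝ), 0 < x ^ s * Real.exp (k * x - x ^ 2 / 2) := fun x hx =>
    mul_pos (Real.rpow_pos_of_pos hx s) (Real.exp_pos _)
  rw [gaussMellin, setIntegral_pos_iff_support_of_nonneg_ae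
    ((ae_restrict_iff' measurableSet_Ioi).2 (Filter.Eventually.of_forall fun x hx =>
      (hpos x hx).le)) (integrableOn_rpow_mul_exp_linear_sub_sq hs k)]
  have hsub : Ioi 0 ⊆ Function.support fun x : ℝ => x ^ s * Real.exp (k * x - x ^ 2 / 2) :=
    fun x hx => (hpos x hx).ne'
  rw [inter_eq_right.2 hsub]
  simp

theorem gaussMellin_monotone {s : ℝ} (hs : -1 < s) : Monotone (gaussMellin s) := by
  intro k l hkl
  refine setIntegral_mono_on (integrableOn_rpow_mul_exp_linear_sub_sq hs k)
    (integrableOn_rpow_mul_exp_linear_sub_sq hs l) measurableSet_Ioi fun x hx => ?_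
  have hx' : 0 < x := hx
  have hp : 0 ≤ x ^ s := Real.rpow_nonneg hx'.le s
  gcongr

theorem hasDerivAt_gaussMellin {s : ℝ} (hs : -1 < s) (k : ℝ) :
    HasDerivAt (gaussMellin s) (gaussMellin (s + 1) k) k := by
  refine (hasDerivAt_integral_of_dominated_loc_of_deriv_le
    (F := fun k x : ℝ => x ^ s * Real.exp (k * x - x ^ 2 / 2))
    (F' := fun k x : ℝ => x ^ (s + 1) * Real.exp (k * x - x ^ 2 / 2))
    (bound := fun x : ℝ => x ^ (s + 1) * Real.exp ((k + 1) * x - x ^ 2 / 2))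
    (Iio_mem_nhds (lt_add_one k))
    (Filter.Eventually.of_forall fun l =>
      (integrableOn_rpow_mul_exp_linear_sub_sq hs l).aestronglyMeasurable)
    (integrableOn_rpow_mul_exp_linear_sub_sq hs k)
    (integrableOn_rpow_mul_exp_linear_sub_sq (by linarith) k).aestronglyMeasurable
    ?_ (integrableOn_rpow_mul_exp_linear_sub_sq (by linarith) (k + 1)) ?_).2
  · refine (ae_restrict_iff' measurableSet_Ioi).2
      (Filter.Eventually.of_forall fun x hx l hl => ?_)
    have hx' : 0 < x := hx
    have hl' : l < k + 1 := hl
    have hp : 0 ≤ x ^ (s + 1) := Real.rpow_nonneg hx'.le _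
    rw [Real.norm_of_nonneg (by positivity)]
    gcongr
  · refine (ae_restrict_iff' measurableSet_Ioi).2
      (Filter.Eventually.of_forall fun x hx l _ => ?_)
    have h := ((((hasDerivAt_id l).mul_const x).sub_const (x ^ 2 / 2)).exp).const_mul (x ^ s)
    refine h.congr_deriv ?_
    rw [Real.rpow_add_one (ne_of_gt hx)]
    simp only [id]
    ring

/-- For a positive function `F` with `F''` positive and monotone, `F b = (b + L) * F' b` has a
unique solution, and `(z + L) / F z` increases strictly before it and decreases strictly after. -/
theorem existsUnique_tangent_of_deriv2_pos {F F₁ F₂ : ℝ → ℝ} (L : ℝ)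
    (hF : ∀ z, HasDerivAt F (F₁ z) z) (hF₁ : ∀ z, HasDerivAt F₁ (F₂ z) z)
    (F_pos : ∀ z, 0 < F z) (F₁_pos : ∀ z, 0 < F₁ z) (F₂_pos : ∀ z, 0 < F₂ z)
    (F₂_mono : Monotone F₂) :
    ∃ b : ℝ, F b = (b + L) * F₁ b ∧ (∀ b', F b' = (b' + L) * F₁ b' → b' = b) ∧ 0 < b + L ∧
      StrictMonoOn (fun z => (z + L) / F z) (Iic b) ∧
      StrictAntiOn (fun z => (z + L) / F z) (Ici b) ∧
      ∀ z, (z + L) / F z ≤ (b + L) / F b := by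
  set g : ℝ → ℝ := fun z => F z - (z + L) * F₁ z with hg_def
  have hg : ∀ z, HasDerivAt g (-((z + L) * F₂ z)) z := fun z =>
    ((hF z).sub (((hasDerivAt_id z).add_const L).mul (hF₁ z))).congr_deriv (by simp)
  have hg_cont : Continuous g := continuous_iff_continuousAt.2 fun z => (hg z).continuousAt
  have hg_left : ∀ z ≤ -L, 0 < g z := fun z hz => by
    have := mul_nonneg (by linarith : 0 ≤ -(z + L)) (F₁_pos z).le
    have := F_pos z
    simp only [hg_def]
    linarith
  have hg_anti : StrictAntiOn g (Ici (-L)) := by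
    refine strictAntiOn_of_deriv_neg (convex_Ici _) hg_cont.continuousOn fun z hz => ?_
    rw [interior_Ici] at hz
    have hz' : -L < z := hz
    rw [(hg z).deriv]
    have := mul_pos (by linarith : 0 < z + L) (F₂_pos z)
    linarith
  obtain ⟨y, hy, hgy⟩ : ∃ y, -L ≤ y ∧ g y ≤ 0 := by
    set m := F₂ (1 - L)
    have hm : 0 < m := F₂_pos _
    have hbound : AntitoneOn (fun z => g z + m * z) (Ici (1 - L)) := by
      have hd : ∀ z, HasDerivAt (fun z => g z + m * z) (-((z + L) * F₂ z) + m) z := fun z =>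
        ((hg z).add ((hasDerivAt_id z).const_mul m)).congr_deriv (by simp)
      refine antitoneOn_of_deriv_nonpos (convex_Ici _)
        (fun z _ => (hd z).continuousAt.continuousWithinAt)
        (fun z _ => (hd z).differentiableAt.differentiableWithinAt) fun z hz => ?_
      rw [interior_Ici] at hz
      have hz' : 1 - L < z := hz
      rw [(hd z).deriv]
      have h1 : m ≤ F₂ z := F₂_mono hz'.le
      nlinarith
    refine ⟨1 - L + |g (1 - L)| / m, ?_, ?_⟩
    · have : 0 ≤ |g (1 - L)| / m := by positivity
      linarith
    · have h0 : 0 ≤ |g (1 - L)| / m := by positivity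
      have h := hbound (self_mem_Ici) (mem_Ici.2 (by linarith)) (le_add_of_nonneg_right h0)
      simp only [mul_add, mul_div_cancel₀ _ hm.ne'] at h
      have := le_abs_self (g (1 - L))
      linarith
  obtain ⟨b, hb, hgb⟩ : 0 ∈ g '' Icc (-L) y :=
    intermediate_value_Icc' hy hg_cont.continuousOn ⟨hgy, (hg_left _ le_rfl).le⟩
  have hbL : -L < b := lt_of_not_ge fun h => (hg_left b h).ne' hgb
  have hpos : ∀ z < b, 0 < g z := fun z hz => by
    rcases le_total z (-L) with h | h
    · exact hg_left z h
    · rw [← hgb]; exact hg_anti h hb.1 hz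
  have hneg : ∀ z, b < z → g z < 0 := fun z hz => by
    rw [← hgb]; exact hg_anti hb.1 (hb.1.trans hz.le) hz
  have hq : ∀ z, HasDerivAt (fun z => (z + L) / F z) (g z / F z ^ 2) z := fun z =>
    (((hasDerivAt_id z).add_const L).div (hF z) (F_pos z).ne').congr_deriv (by simp [hg_def])
  have hq_cont : Continuous fun z => (z + L) / F z :=
    continuous_iff_continuousAt.2 fun z => (hq z).continuousAt
  have hmono : StrictMonoOn (fun z => (z + L) / F z) (Iic b) := by
    refine strictMonoOn_of_deriv_pos (convex_Iic _) hq_cont.continuousOn fun z hz => ?_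
    rw [interior_Iic] at hz
    rw [(hq z).deriv]
    exact div_pos (hpos z hz) (pow_pos (F_pos z) 2)
  have hanti : StrictAntiOn (fun z => (z + L) / F z) (Ici b) := by
    refine strictAntiOn_of_deriv_neg (convex_Ici _) hq_cont.continuousOn fun z hz => ?_
    rw [interior_Ici] at hz
    rw [(hq z).deriv]
    exact div_neg_of_neg_of_pos (hneg z hz) (pow_pos (F_pos z) 2)
  refine ⟨b, sub_eq_zero.1 hgb, fun b' hb' => ?_, by linarith, hmono, hanti, fun z => ?_⟩
  · have h0 : g b' = 0 := sub_eq_zero.2 hb'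
    rcases lt_trichotomy b' b with h | h | h
    · exact absurd h0 (hpos _ h).ne'
    · exact h
    · exact absurd h0 (hneg _ h).ne
  · rcases le_total z b with h | h
    · exact hmono.monotoneOn h self_mem_Iic h
    · exact hanti.antitoneOn self_mem_Ici h h

/-- For κ, η, r, ν > 0 and θ ∈ ℝ, there is a unique b solving
F(b) = (b + log ν)F'(b); it satisfies b + log ν > 0, and
z ↦ (z + log ν)/F(z) is strictly increasing on (−∞, b], strictly decreasing
on [b, ∞), hence maximized at b. -/
theorem xou_log_threshold (κ θ η r ν : ℝ)
    (hκ : 0 < κ) (hη : 0 < η) (hr : 0 < r) (hν : 0 < ν) :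
    ∃ b : ℝ,
      (ouF κ θ η r b = (b + Real.log ν) * deriv (ouF κ θ η r) b) ∧
      (∀ b' : ℝ, ouF κ θ η r b' = (b' + Real.log ν) * deriv (ouF κ θ η r) b'
        → b' = b) ∧
      0 < b + Real.log ν ∧
      StrictMonoOn (fun z => (z + Real.log ν) / ouF κ θ η r z) (Set.Iic b) ∧
      StrictAntiOn (fun z => (z + Real.log ν) / ouF κ θ η r z) (Set.Ici b) ∧
      (∀ z : ℝ, (z + Real.log ν) / ouF κ θ η r z
        ≤ (b + Real.log ν) / ouF κ θ η r b) := by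
  set c := Real.sqrt (2 * κ / η ^ 2)
  have hc : 0 < c := Real.sqrt_pos.2 (by positivity)
  have hs : -1 < r / κ - 1 := by
    have : 0 < r / κ := by positivity
    linarith
  have hu : ∀ z, HasDerivAt (fun z => c * (z - θ)) c z := fun z =>
    (((hasDerivAt_id z).sub_const θ).const_mul c).congr_deriv (by simp)
  have hF : ∀ z, HasDerivAt (ouF κ θ η r)
      (gaussMellin (r / κ - 1 + 1) (c * (z - θ)) * c) z := fun z =>
    (hasDerivAt_gaussMellin hs _).comp z (hu z)
  have hF₁ : ∀ z, HasDerivAt (fun z => gaussMellin (r / κ - 1 + 1) (c * (z - θ)) * c)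
      (gaussMellin (r / κ - 1 + 1 + 1) (c * (z - θ)) * c * c) z := fun z =>
    ((hasDerivAt_gaussMellin (by linarith) _).comp z (hu z)).mul_const c
  have hderiv : deriv (ouF κ θ η r) = fun z => gaussMellin (r / κ - 1 + 1) (c * (z - θ)) * c :=
    funext fun z => (hF z).deriv
  rw [hderiv]
  refine existsUnique_tangent_of_deriv2_pos (Real.log ν) hF hF₁ (fun z => gaussMellin_pos hs _)
    (fun z => mul_pos (gaussMellin_pos (by linarith) _) hc)
    (fun z => mul_pos (mul_pos (gaussMellin_pos (by linarith) _) hc) hc) fun x y hxy => ?_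
  have := gaussMellin_monotone (s := r / κ - 1 + 1 + 1) (by linarith)
    (by gcongr : c * (x - θ) ≤ c * (y - θ))
  gcongr
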